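/- Let k be a field of characteristic zero, let n ≥ 1, let f ∈ k[t][x_0,…,x_n] be homogeneous in x_0,…,x_n of degree d ≥ 1, let ℓ ≥ 1, and let b ∈ k[t][x_0,…,x_n] be homogeneous in x_0,…,x_n of degree ℓ·d − (n+1). Set f_reg = f + ε·Σ_{i=0}^n x_i^d, a polynomial over k(t)[ε] homogeneous in x of degree d. Suppose c_0,…,c_r ∈ k(t)[ε] form a telescoper with regular certificate of order r for b/f_reg^ℓ over the field k(t,ε): there exist m ∈ ℕ and B_0,…,B_n ∈ k(t,ε)[x_0,…,x_n] with (Σ_{j=0}^r c_j·P_j·f_reg^{r−j})·f_reg^{m+1} = f_reg^{ℓ+r}·Σ_{i=0}^n (f_reg·∂_i B_i − m·B_i·∂_i f_reg), where P_0 = b and P_{j+1} = f_reg·∂_t P_j − (ℓ+j)·P_j·∂_t f_reg. Let c̄_j = c_j|_{ε=0} ∈ k(t), let f̄ = f|_{x_0=1} and b̄ = b|_{x_0=1} in k[t][x_1,…,x_n]. Then c̄_0,…,c̄_r is a telescoping family with regular certificate for b̄/f̄^ℓ in the n affine variables: there exist q ∈ ℕ and h_1,…,h_n ∈ k(t)[x_1,…,x_n]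 such that (Σ_{j=0}^r c̄_j·Q_j·f̄^{r−j})·f̄^{q+1} = f̄^{ℓ+r}·Σ_{i=1}^n (f̄·∂_i h_i − q·h_i·∂_i f̄), where Q_0 = b̄ and Q_{j+1} = f̄·∂_t Q_j − (ℓ+j)·Q_j·∂_t f̄. -/

import Mathlib

open MvPolynomial

section Defs

variable {k : Type*} [Field k]

/-- `∂_t` on `k[t][ε]` (inner variable `t`, outer variable `ε`), acting
coefficientwise by `d/dt`. -/
noncomputable def dtPoly (p : Polynomial (Polynomial k)) : Polynomial (Polynomial k) :=
  p.sum fun i c => Polynomial.monomial i (Polynomial.derivative c)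

/-- `∂_t` on polynomials in the `x`-variables with coefficients in `k[t]`. -/
noncomputable def dtMv {σ : Type*} (P : MvPolynomial σ (Polynomial k)) :
    MvPolynomial σ (Polynomial k) :=
  ∑ m ∈ P.support, monomial m (Polynomial.derivative (P.coeff m))

/-- `∂_t` on polynomials in the `x`-variables with coefficients in `k[t][ε]`. -/
noncomputable def dtMvE {σ : Type*} (P : MvPolynomial σ (Polynomial (Polynomial k))) :
    MvPolynomial σ (Polynomial (Polynomial k)) :=
  ∑ m ∈ P.support, monomial m (dtPoly (P.coeff m))

/-- The sequence of numerators `P_j` with `∂_t^j(a/f^ℓ) = P_j/f^{ℓ+j}`: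
`P_0 = a` and `P_{j+1} = f·∂_t P_j − (ℓ+j)·P_j·∂_t f`. -/
noncomputable def telSeq {A : Type*} [CommRing A] (D : A → A) (f a : A) (ℓ : ℕ) :
    ℕ → A
  | 0 => a
  | j + 1 => f * D (telSeq D f a ℓ j)
      - ((ℓ + j : ℕ) : A) * telSeq D f a ℓ j * D f

/-- The deformation `f_reg = f + ε·Σ_i x_i^d`, as a polynomial in `x₀,…,x_n`
with coefficients in `k[t][ε]`. -/
noncomputable def fReg (n d : ℕ) (f : MvPolynomial (Fin (n + 1)) (Polynomial k)) :
    MvPolynomial (Fin (n + 1)) (Polynomial (Polynomial k)) :=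
  MvPolynomial.map (Polynomial.C : Polynomial k →+* Polynomial (Polynomial k)) f
    + MvPolynomial.C Polynomial.X * ∑ i : Fin (n + 1), X i ^ d

/-- The inclusion `k[t][ε] → k(t)(ε) = k(t,ε)`. -/
noncomputable def toKtε : Polynomial (Polynomial k) →+* RatFunc (RatFunc k) :=
  (algebraMap (Polynomial (RatFunc k)) (RatFunc (RatFunc k))).comp
    (Polynomial.mapRingHom (algebraMap (Polynomial k) (RatFunc k)))

/-- Dehomogenization: the substitution `x₀ ↦ 1`, `x_i ↦ x_{i-1}`. -/
noncomputable def dehom {L : Type*} [CommSemiring L] {n : ℕ} :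
    MvPolynomial (Fin (n + 1)) L →+* MvPolynomial (Fin n) L :=
  eval₂Hom MvPolynomial.C (Fin.cases 1 fun i => X i)

end Defs

section EpsilonCoefficients

variable {K σ : Type*} [Field K]

/-- The exchange of variables `K[ε][x] → K[x][ε]`. -/
noncomputable def epsOut : MvPolynomial σ (Polynomial K) →+* Polynomial (MvPolynomial σ K) :=
  eval₂Hom (Polynomial.mapRingHom MvPolynomial.C) fun i => Polynomial.C (X i)

theorem epsOut_C (p : Polynomial K) :
    epsOut (MvPolynomial.C p : MvPolynomial σ (Polynomial K))
      = p.map MvPolynomial.C := by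
  simp [epsOut]

theorem epsOut_map_C (a : MvPolynomial σ K) :
    epsOut (MvPolynomial.map Polynomial.C a) = Polynomial.C a := by
  have h : (epsOut (K := K) (σ := σ)).comp (MvPolynomial.map Polynomial.C) = Polynomial.C := by
    ext <;> simp [epsOut]
  exact congrArg (fun φ => φ a) h

theorem coeff_coeff_epsOut (p : MvPolynomial σ (Polynomial K)) (s : ℕ) (m : σ →₀ ℕ) :
    ((epsOut p).coeff s).coeff m = (p.coeff m).coeff s := by
  classical
  induction p using MvPolynomial.induction_on' with
  | monomial u c =>
    have h : epsOut (monomial u c) = Polynomial.map MvPolynomial.C c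
        * Polynomial.C (monomial u (1 : K)) := by
      rw [← epsOut_map_C, ← epsOut_C, ← map_mul, map_monomial, C_mul_monomial]
      simp
    rw [h, Polynomial.coeff_mul_C, Polynomial.coeff_map, C_mul_monomial, coeff_monomial,
      coeff_monomial]
    split_ifs <;> simp
  | add p q hp hq => simp [hp, hq]

theorem coeff_epsOut_pderiv (p : MvPolynomial σ (Polynomial K)) (s : ℕ) (i : σ) :
    (epsOut (pderiv i p)).coeff s = pderiv i ((epsOut p).coeff s) := by
  ext m
  rw [coeff_coeff_epsOut, coeff_pderiv, coeff_pderiv, coeff_coeff_epsOut]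
  have h : ((m i : Polynomial K) + 1) = Polynomial.C ((m i : K) + 1) := by simp
  rw [h, Polynomial.coeff_mul_C]

theorem coeff_zero_epsOut (p : MvPolynomial σ (Polynomial K)) :
    (epsOut p).coeff 0 = MvPolynomial.map (Polynomial.evalRingHom 0) p := by
  ext m
  rw [coeff_coeff_epsOut, coeff_map, Polynomial.coe_evalRingHom, Polynomial.coeff_zero_eq_eval_zero]

theorem C_X_dvd_sub_map_C (g : MvPolynomial σ (Polynomial K)) :
    (MvPolynomial.C Polynomial.X : MvPolynomial σ (Polynomial K)) ∣
      MvPolynomial.map Polynomial.C (MvPolynomial.map (Polynomial.evalRingHom 0) g) - g := by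
  rw [C_dvd_iff_dvd_coeff]
  intro m
  simp [Polynomial.X_dvd_iff, coeff_map, Polynomial.coeff_zero_eq_eval_zero]

end EpsilonCoefficients

section Certificates

variable {R A : Type*} [CommRing R] [CommRing A] [Algebra R A]

/-- The numerators `g * D B - m * B * D g` of `D (B / g ^ m)` before and after expanding
the fraction by `g' ^ m`. -/
theorem certificate_mul_pow (D : Derivation R A A) (g g' B : A) (m : ℕ) :
    (g * g') * D (B * g' ^ m) - m * (B * g' ^ m) * D (g * g')
      = g' ^ (m + 1) * (g * D B - m * B * D g) := by
  rcases m with _ | m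
  · simp; ring
  · simp only [Derivation.leibniz, Derivation.leibniz_pow, smul_eq_mul, nsmul_eq_mul,
      Nat.add_sub_cancel]
    push_cast
    ring

theorem certificate_pow (D : Derivation R A A) (f B : A) (m s : ℕ) :
    f ^ (s + 1) * D B - m * B * D (f ^ (s + 1))
      = f ^ s * (f * D B - ((m * (s + 1) : ℕ) : A) * B * D f) := by
  simp only [Derivation.leibniz_pow, smul_eq_mul, nsmul_eq_mul, Nat.add_sub_cancel]
  push_cast
  ring

theorem certificate_raise (D : Derivation R A A) (f B : A) (q j : ℕ) :
    f * D (B * f ^ j) - ((q + j : ℕ) : A) * (B * f ^ j) * D f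
      = f ^ j * (f * D B - q * B * D f) := by
  rcases j with _ | j
  · simp
  · simp only [Derivation.leibniz, Derivation.leibniz_pow, smul_eq_mul, nsmul_eq_mul,
      Nat.add_sub_cancel]
    push_cast
    ring

end Certificates

section Specialization

variable {K σ : Type*} [Field K] [Fintype σ]

/-- Specialization at `ε = 0` of a certificate known modulo `ε ^ (s + 1)`. -/
theorem exists_certificate_of_congr (f : MvPolynomial σ K) (hf : f ≠ 0)
    (g L W : MvPolynomial σ (Polynomial K))
    (hg : MvPolynomial.map (Polynomial.evalRingHom 0) g = f) (m N s : ℕ)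
    (B : σ → MvPolynomial σ (Polynomial K))
    (h : MvPolynomial.C Polynomial.X ^ s * L * g ^ (m + 1)
      = g ^ N * ∑ i, (g * pderiv i (B i) - m * B i * pderiv i g)
        + MvPolynomial.C Polynomial.X ^ (s + 1) * W) :
    ∃ (q : ℕ) (H : σ → MvPolynomial σ K),
      MvPolynomial.map (Polynomial.evalRingHom 0) L * f ^ (q + 1)
        = f ^ N * ∑ i, (f * pderiv i (H i) - q * H i * pderiv i f) := by
  set ε : MvPolynomial σ (Polynomial K) := MvPolynomial.C Polynomial.X with hε
  set F : MvPolynomial σ (Polynomial K) := MvPolynomial.map Polynomial.C (f ^ (s + 1)) with hF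
  have hΦε : epsOut ε = (Polynomial.X : Polynomial (MvPolynomial σ K)) := by
    rw [hε, epsOut_C, Polynomial.map_X]
  obtain ⟨g', V, hG⟩ : ∃ g' V, g * g' = F + ε ^ (s + 1) * V := by
    obtain ⟨u, hu⟩ := C_X_dvd_sub_map_C g
    rw [hg] at hu
    obtain ⟨g', hg'⟩ := sub_dvd_pow_sub_pow (MvPolynomial.map Polynomial.C f) (ε * u) (s + 1)
    refine ⟨g', -u ^ (s + 1), ?_⟩
    have : MvPolynomial.map Polynomial.C f - ε * u = g := by rw [← hu]; ring
    rw [this] at hg'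
    rw [← hg', hF, map_pow, mul_pow]
    ring
  have hev : MvPolynomial.map (Polynomial.evalRingHom 0) g' = f ^ s := by
    apply mul_left_cancel₀ hf
    have := congrArg (MvPolynomial.map (Polynomial.evalRingHom (0 : K))) hG
    have hc : (Polynomial.evalRingHom (0 : K)).comp Polynomial.C = RingHom.id K := by ext; simp
    rw [map_mul, hg, map_add, map_mul, map_pow, hε, hF, MvPolynomial.map_map, map_C, hc,
      MvPolynomial.map_id, Polynomial.coe_evalRingHom, Polynomial.eval_X, map_zero] at this
    rw [this, zero_pow s.succ_ne_zero, zero_mul, add_zero, pow_succ']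
  set Cc : σ → MvPolynomial σ (Polynomial K) := fun i => B i * g' ^ m with hCc
  have exact_eq : ε ^ s * (L * g' ^ N) * (g * g') ^ (m + 1)
      = (g * g') ^ N * ∑ i, ((g * g') * pderiv i (Cc i) - m * Cc i * pderiv i (g * g'))
        + ε ^ (s + 1) * (W * g' ^ N * g' ^ (m + 1)) := by
    simp only [hCc, certificate_mul_pow, ← Finset.mul_sum]
    linear_combination g' ^ N * g' ^ (m + 1) * h
  have congr_eq : ε ^ (s + 1) ∣ ε ^ s * (L * g' ^ N) * F ^ (m + 1)
      - F ^ N * ∑ i, (F * pderiv i (Cc i) - m * Cc i * pderiv i F) := by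
    rw [← Ideal.mem_span_singleton, ← Ideal.Quotient.eq]
    set π := Ideal.Quotient.mk (Ideal.span {ε ^ (s + 1)})
    have hπ (w) : π (ε ^ (s + 1) * w) = 0 :=
      Ideal.Quotient.eq_zero_iff_mem.2 (Ideal.mem_span_singleton.2 (dvd_mul_right _ _))
    have hπG : π (g * g') = π F := by rw [hG, map_add, hπ, add_zero]
    have hD (i : σ) : pderiv i (ε ^ (s + 1) * V) = ε ^ (s + 1) * pderiv i V := by
      rw [hε, ← map_pow, pderiv_C_mul]
    have hπD (i : σ) : π (pderiv i (g * g')) = π (pderiv i F) := by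
      rw [hG, map_add, hD, map_add, hπ, add_zero]
    have := congrArg π exact_eq
    rw [map_add, hπ, add_zero] at this
    simp only [map_mul π _ (_ ^ _), map_mul π (_ ^ _), map_pow, map_sum, map_sub, hπG,
      map_mul π (g * g'), map_mul π _ (pderiv _ _), hπD] at this
    simpa only [map_mul, map_pow, map_sum, map_sub] using this
  obtain ⟨T, hT⟩ := congr_eq
  have hcoeff := congrArg (fun p => (epsOut p).coeff s) (sub_eq_iff_eq_add.1 hT)
  set H : σ → MvPolynomial σ K := fun i => (epsOut (Cc i)).coeff s with hH
  refine ⟨m * (s + 1), H, ?_⟩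
  have lhs_eq : (epsOut (ε ^ s * (L * g' ^ N) * F ^ (m + 1))).coeff s
      = MvPolynomial.map (Polynomial.evalRingHom 0) L * (f ^ s) ^ N * (f ^ (s + 1)) ^ (m + 1) := by
    rw [hF, map_mul, map_pow epsOut (MvPolynomial.map Polynomial.C _), epsOut_map_C,
      ← map_pow Polynomial.C, Polynomial.coeff_mul_C, map_mul, map_pow, hΦε,
      Polynomial.coeff_X_pow_mul', if_pos le_rfl, Nat.sub_self, coeff_zero_epsOut, map_mul,
      map_pow, hev]
  have rhs_eq : (epsOut (ε ^ (s + 1) * T + F ^ N * ∑ i, (F * pderiv i (Cc i)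
        - m * Cc i * pderiv i F))).coeff s
      = (f ^ (s + 1)) ^ N * ∑ i, (f ^ (s + 1) * pderiv i (H i)
        - m * H i * pderiv i (f ^ (s + 1))) := by
    rw [map_add, Polynomial.coeff_add, map_mul, map_pow, hΦε, Polynomial.coeff_X_pow_mul',
      if_neg (by omega), zero_add, hF, map_mul, map_pow, epsOut_map_C, ← map_pow,
      Polynomial.coeff_C_mul,
      map_sum, Polynomial.finsetSum_coeff]
    congr 1
    refine Finset.sum_congr rfl fun i _ => ?_
    rw [map_sub, Polynomial.coeff_sub, map_mul, epsOut_map_C, Polynomial.coeff_C_mul,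
      coeff_epsOut_pderiv, pderiv_map, map_mul _ (_ * _), epsOut_map_C, Polynomial.coeff_mul_C,
      map_mul _ (m : MvPolynomial σ (Polynomial K)), map_natCast, Polynomial.coeff_natCast_mul]
  have key := lhs_eq.symm.trans (hcoeff.trans rhs_eq)
  simp only [certificate_pow, ← Finset.mul_sum] at key
  apply mul_left_cancel₀ (pow_ne_zero (s * N + s) hf)
  linear_combination key

end Specialization

section Homogeneous

variable {K : Type*} [CommRing K] {σ : Type*}

theorem homogeneousComponent_mul_of_isHomogeneous {f : MvPolynomial σ K} {d : ℕ}
    (hf : f.IsHomogeneous d) (p : MvPolynomial σ K) (e : ℕ) :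
    homogeneousComponent (d + e) (f * p) = f * homogeneousComponent e p := by
  classical
  conv_lhs => rw [← sum_homogeneousComponent p, Finset.mul_sum, map_sum]
  have h (j : ℕ) : homogeneousComponent (d + e) (f * homogeneousComponent j p)
      = if j = e then f * homogeneousComponent e p else 0 := by
    rw [homogeneousComponent_of_mem (hf.mul (homogeneousComponent_isHomogeneous j p))]
    by_cases hj : j = e
    · simp [hj]
    · rw [if_neg (by omega), if_neg hj]
  simp only [h, Finset.sum_ite_eq', Finset.mem_range]
  split_ifs with hlt
  · rfl
  · rw [homogeneousComponent_eq_zero _ _ (by omega), mul_zero]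

theorem homogeneousComponent_pderiv (p : MvPolynomial σ K) (i : σ) (e : ℕ) :
    homogeneousComponent e (pderiv i p) = pderiv i (homogeneousComponent (e + 1) p) := by
  ext m
  simp only [coeff_homogeneousComponent, coeff_pderiv, map_add,
    Finsupp.degree_single, add_left_inj]
  split_ifs <;> simp

theorem homogeneousComponent_certificate {f : MvPolynomial σ K} {d : ℕ} (hd : 1 ≤ d)
    (hf : f.IsHomogeneous d) (B : MvPolynomial σ K) (i : σ) (q e : ℕ) :
    homogeneousComponent (d + e) (f * pderiv i B - (q : MvPolynomial σ K) * B * pderiv i f)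
      = f * pderiv i (homogeneousComponent (e + 1) B)
        - (q : MvPolynomial σ K) * homogeneousComponent (e + 1) B * pderiv i f := by
  have hdf : (pderiv i f).IsHomogeneous (d - 1) := hf.pderiv
  rw [map_sub, homogeneousComponent_mul_of_isHomogeneous hf, homogeneousComponent_pderiv,
    show (q : MvPolynomial σ K) * B * pderiv i f = MvPolynomial.C (q : K) * (pderiv i f * B) by
      rw [map_natCast]; ring,
    homogeneousComponent_C_mul, show d + e = (d - 1) + (e + 1) by omega,
    homogeneousComponent_mul_of_isHomogeneous hdf, map_natCast]
  ring

end Homogeneous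

section Dehomogenization

variable {K : Type*} [CommRing K] {n : ℕ}

theorem dehom_C (a : K) : dehom (n := n) (MvPolynomial.C a) = MvPolynomial.C a := by
  simp [dehom]

theorem dehom_X_zero : dehom (L := K) (n := n) (X 0) = 1 := by
  simp [dehom]

theorem dehom_X_succ (i : Fin n) : dehom (L := K) (X i.succ) = X i := by
  simp [dehom]

theorem dehom_map {K' : Type*} [CommRing K'] (φ : K →+* K') (p : MvPolynomial (Fin (n + 1)) K) :
    dehom (MvPolynomial.map φ p) = MvPolynomial.map φ (dehom p) := by
  have h : dehom.comp (MvPolynomial.map φ) = (MvPolynomial.map φ).comp (dehom (L := K) (n := n)) := by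
    apply MvPolynomial.ringHom_ext
    · intro a; simp [dehom_C]
    · intro i
      cases i using Fin.cases <;> simp [dehom_X_zero, dehom_X_succ]
  exact congrArg (fun ψ => ψ p) h

theorem dehom_pderiv_succ (p : MvPolynomial (Fin (n + 1)) K) (i : Fin n) :
    dehom (pderiv i.succ p) = pderiv i (dehom p) := by
  induction p using MvPolynomial.induction_on with
  | C a => simp [dehom_C]
  | add p q hp hq => simp [hp, hq]
  | mul_X p j hp =>
    rw [pderiv_mul, map_add, map_mul, map_mul, hp, map_mul, pderiv_mul]
    congr 2
    cases j using Fin.cases with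
    | zero => simp [dehom_X_zero, pderiv_X_of_ne (Fin.succ_ne_zero i).symm]
    | succ j =>
      classical
      rw [dehom_X_succ, pderiv_X, pderiv_X]
      by_cases hij : i = j
      · subst hij; simp
      · simp [Ne.symm hij]

/-- Euler's identity after the substitution `x₀ = 1`. -/
theorem dehom_pderiv_zero {p : MvPolynomial (Fin (n + 1)) K} {e : ℕ} (hp : p.IsHomogeneous e) :
    dehom (pderiv 0 p) = (e : MvPolynomial (Fin n) K) * dehom p
      - ∑ i, X i * pderiv i (dehom p) := by
  have h := congrArg dehom hp.sum_X_mul_pderiv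
  rw [Fin.sum_univ_succ, map_add, map_mul, dehom_X_zero, one_mul, map_sum, map_nsmul,
    nsmul_eq_mul] at h
  simp only [map_mul, dehom_X_succ, dehom_pderiv_succ] at h
  linear_combination h

theorem dehom_certificate {f : MvPolynomial (Fin (n + 1)) K} {d q e : ℕ} (hf : f.IsHomogeneous d)
    {B : Fin (n + 1) → MvPolynomial (Fin (n + 1)) K} (hB : (B 0).IsHomogeneous e)
    (he : e + n = q * d) :
    dehom (∑ i, (f * pderiv i (B i) - (q : MvPolynomial (Fin (n + 1)) K) * B i * pderiv i f))
      = ∑ i : Fin n, (dehom f * pderiv i (dehom (B i.succ) - X i * dehom (B 0))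
          - (q : MvPolynomial (Fin n) K) * (dehom (B i.succ) - X i * dehom (B 0))
            * pderiv i (dehom f)) := by
  have he' : (e : MvPolynomial (Fin n) K) + n = q * d := by exact_mod_cast congrArg Nat.cast he
  have hterm (i : Fin n) : dehom f * pderiv i (dehom (B i.succ) - X i * dehom (B 0))
        - (q : MvPolynomial (Fin n) K) * (dehom (B i.succ) - X i * dehom (B 0))
            * pderiv i (dehom f)
      = (dehom f * pderiv i (dehom (B i.succ))
          - (q : MvPolynomial (Fin n) K) * dehom (B i.succ) * pderiv i (dehom f))
        - dehom f * dehom (B 0) - dehom f * (X i * pderiv i (dehom (B 0)))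
        + (q : MvPolynomial (Fin n) K) * dehom (B 0) * (X i * pderiv i (dehom f)) := by
    rw [map_sub, pderiv_mul, pderiv_X_self]
    ring
  simp only [hterm, Finset.sum_add_distrib, Finset.sum_sub_distrib, ← Finset.mul_sum]
  simp only [Fin.sum_univ_succ, map_add, map_sub, map_mul, map_sum, map_natCast,
    dehom_pderiv_succ, dehom_pderiv_zero hf, dehom_pderiv_zero hB, Finset.sum_const,
    Finset.card_univ, Fintype.card_fin, nsmul_eq_mul]
  linear_combination dehom f * dehom (B 0) * he'

end Dehomogenization

section ParameterDerivative

variable {k : Type*} [Field k] {σ : Type*}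

theorem coeff_dtMv (P : MvPolynomial σ (Polynomial k)) (m : σ →₀ ℕ) :
    (dtMv P).coeff m = Polynomial.derivative (P.coeff m) := by
  classical
  simp only [dtMv, coeff_sum, coeff_monomial, Finset.sum_ite_eq', mem_support_iff]
  split_ifs with h
  · rfl
  · simp [not_not.1 h]

theorem coeff_dtPoly (p : Polynomial (Polynomial k)) (s : ℕ) :
    (dtPoly p).coeff s = Polynomial.derivative (p.coeff s) := by
  simp only [dtPoly, Polynomial.sum, Polynomial.finsetSum_coeff, Polynomial.coeff_monomial,
    Finset.sum_ite_eq']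
  split_ifs with h
  · rfl
  · simp [Polynomial.notMem_support_iff.1 h]

theorem coeff_dtMvE (P : MvPolynomial σ (Polynomial (Polynomial k))) (m : σ →₀ ℕ) :
    (dtMvE P).coeff m = dtPoly (P.coeff m) := by
  classical
  simp only [dtMvE, coeff_sum, coeff_monomial, Finset.sum_ite_eq', mem_support_iff]
  split_ifs with h
  · rfl
  · simp [not_not.1 h, dtPoly]

theorem map_eval_zero_dtMvE (P : MvPolynomial σ (Polynomial (Polynomial k))) :
    MvPolynomial.map (Polynomial.evalRingHom 0) (dtMvE P)
      = dtMv (MvPolynomial.map (Polynomial.evalRingHom 0) P) := by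
  ext1 m
  simp only [coeff_map, coeff_dtMvE, coeff_dtMv, Polynomial.coe_evalRingHom,
    ← Polynomial.coeff_zero_eq_eval_zero, coeff_dtPoly]

theorem dtMv_add (P Q : MvPolynomial σ (Polynomial k)) : dtMv (P + Q) = dtMv P + dtMv Q := by
  ext1 m
  simp [coeff_dtMv]

theorem dtMv_monomial (m : σ →₀ ℕ) (a : Polynomial k) :
    dtMv (monomial m a) = monomial m (Polynomial.derivative a) := by
  classical
  ext1 m'
  rw [coeff_dtMv, coeff_monomial, coeff_monomial]
  split_ifs <;> simp

theorem dtMv_mul_X (P : MvPolynomial σ (Polynomial k)) (i : σ) : dtMv (P * X i) = dtMv P * X i := by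
  classical
  ext1 m
  rw [coeff_dtMv, coeff_mul_X', coeff_mul_X', coeff_dtMv]
  split_ifs <;> simp

theorem dehom_dtMv {n : ℕ} (P : MvPolynomial (Fin (n + 1)) (Polynomial k)) :
    dehom (dtMv P) = dtMv (dehom P) := by
  induction P using MvPolynomial.induction_on with
  | C a => rw [dehom_C, C_apply, dtMv_monomial, C_apply, dtMv_monomial, ← C_apply, ← C_apply, dehom_C]
  | add p q hp hq => rw [dtMv_add, map_add, hp, hq, map_add, dtMv_add]
  | mul_X p j hp =>
    rw [dtMv_mul_X, map_mul, map_mul, hp]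
    cases j using Fin.cases with
    | zero => simp [dehom_X_zero]
    | succ j => rw [dehom_X_succ, dtMv_mul_X]

theorem isHomogeneous_dtMv {P : MvPolynomial σ (Polynomial k)} {e : ℕ} (hP : P.IsHomogeneous e) :
    (dtMv P).IsHomogeneous e := by
  intro m hm
  apply hP
  rintro h
  simp [coeff_dtMv, h] at hm

theorem map_telSeq {A A' : Type*} [CommRing A] [CommRing A'] (φ : A →+* A') {D : A → A}
    {D' : A' → A'} (hD : ∀ a, φ (D a) = D' (φ a)) (f a : A) (ℓ j : ℕ) :
    φ (telSeq D f a ℓ j) = telSeq D' (φ f) (φ a) ℓ j := by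
  induction j with
  | zero => rfl
  | succ j ih => simp only [telSeq, map_sub, map_mul, hD, ih, map_natCast]

theorem isHomogeneous_telSeq {f a : MvPolynomial σ (Polynomial k)} {d e : ℕ}
    (hf : f.IsHomogeneous d) (ha : a.IsHomogeneous e) (ℓ j : ℕ) :
    (telSeq dtMv f a ℓ j).IsHomogeneous (e + j * d) := by
  induction j with
  | zero => simpa [telSeq] using ha
  | succ j ih =>
    rw [telSeq, show e + (j + 1) * d = d + (e + j * d) by ring]
    refine (hf.mul (isHomogeneous_dtMv ih)).sub ?_
    rw [← map_natCast (MvPolynomial.C : Polynomial k →+* MvPolynomial σ (Polynomial k)),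
      mul_assoc, mul_comm (telSeq _ _ _ _ _)]
    exact ((isHomogeneous_dtMv hf).mul ih).C_mul _

end ParameterDerivative

section ClearingDenominators

attribute [local instance] MvPolynomial.algebraMvPolynomial

variable {K σ : Type*} [Field K] [Fintype σ]

theorem exists_certificate_of_ratFunc (f : MvPolynomial σ K) (hf : f ≠ 0)
    (g L : MvPolynomial σ (Polynomial K))
    (hg : MvPolynomial.map (Polynomial.evalRingHom 0) g = f) (m N : ℕ)
    (B : σ → MvPolynomial σ (RatFunc K))
    (h : MvPolynomial.map (algebraMap (Polynomial K) (RatFunc K)) L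
          * MvPolynomial.map (algebraMap (Polynomial K) (RatFunc K)) g ^ (m + 1)
      = MvPolynomial.map (algebraMap (Polynomial K) (RatFunc K)) g ^ N
        * ∑ i, (MvPolynomial.map (algebraMap (Polynomial K) (RatFunc K)) g * pderiv i (B i)
          - m * B i * pderiv i (MvPolynomial.map (algebraMap (Polynomial K) (RatFunc K)) g))) :
    ∃ (q : ℕ) (H : σ → MvPolynomial σ K),
      MvPolynomial.map (Polynomial.evalRingHom 0) L * f ^ (q + 1)
        = f ^ N * ∑ i, (f * pderiv i (H i) - q * H i * pderiv i f) := by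
  set ι := algebraMap (Polynomial K) (RatFunc K) with hι
  obtain ⟨D, hD, B', hB'⟩ : ∃ D : Polynomial K, D ≠ 0 ∧
      ∃ B' : σ → MvPolynomial σ (Polynomial K),
        ∀ i, MvPolynomial.map ι (B' i) = MvPolynomial.C (ι D) * B i := by
    obtain ⟨⟨_, D, hD, rfl⟩, hb⟩ := IsLocalization.exist_integer_multiples_of_finite
      ((nonZeroDivisors (Polynomial K)).map (MvPolynomial.C (σ := σ))) B
    choose B' hB' using hb
    refine ⟨D, nonZeroDivisors.ne_zero hD, B', fun i => ?_⟩
    have := hB' i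
    rw [Algebra.smul_def, MvPolynomial.algebraMap_def] at this
    simpa using this
  have hpoly : MvPolynomial.C D * L * g ^ (m + 1)
      = g ^ N * ∑ i, (g * pderiv i (B' i) - m * B' i * pderiv i g) := by
    apply MvPolynomial.map_injective ι (IsFractionRing.injective _ _)
    simp only [map_mul, map_pow, map_sum, map_sub, map_natCast, ← pderiv_map, hB', map_C,
      pderiv_C_mul]
    rw [mul_assoc, h, mul_left_comm, Finset.mul_sum]
    congr 1
    exact Finset.sum_congr rfl fun i _ => by ring
  obtain ⟨D', hDD', hX⟩ := Polynomial.exists_eq_pow_rootMultiplicity_mul_and_not_dvd D hD 0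
  set s := D.rootMultiplicity 0
  rw [map_zero, sub_zero] at hDD' hX
  obtain ⟨U, V, hUV⟩ : IsCoprime D' (Polynomial.X ^ (s + 1)) :=
    (((Polynomial.irreducible_X (R := K)).coprime_iff_not_dvd.2 hX).symm).pow_right
  refine exists_certificate_of_congr f hf g L
    (MvPolynomial.C (Polynomial.X ^ s * V) * L * g ^ (m + 1)) hg m N s
    (fun i => MvPolynomial.C U * B' i) ?_
  have hsum : ∑ i, (g * pderiv i (MvPolynomial.C U * B' i)
        - (m : MvPolynomial σ (Polynomial K)) * (MvPolynomial.C U * B' i) * pderiv i g)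
      = MvPolynomial.C U * ∑ i, (g * pderiv i (B' i) - m * B' i * pderiv i g) := by
    rw [Finset.mul_sum]
    exact Finset.sum_congr rfl fun i _ => by rw [pderiv_C_mul]; ring
  have hUV' := congrArg (MvPolynomial.C (σ := σ)) hUV
  rw [hDD'] at hpoly
  simp only [map_add, map_mul, map_pow, map_one] at hUV' hpoly ⊢
  rw [hsum]
  linear_combination MvPolynomial.C U * hpoly
    - MvPolynomial.C Polynomial.X ^ s * L * g ^ (m + 1) * hUV'

end ClearingDenominators

/-- A certificate for a homogeneous numerator yields a certificate after setting `x₀ = 1`. -/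
theorem exists_certificate_dehom {K : Type*} [Field K] {n d e N q : ℕ} (hd : 1 ≤ d)
    {f L : MvPolynomial (Fin (n + 1)) K} (hf : f.IsHomogeneous d)
    (hL : L.IsHomogeneous e) (he : e + (n + 1) = N * d)
    {H : Fin (n + 1) → MvPolynomial (Fin (n + 1)) K}
    (h : L * f ^ (q + 1) = f ^ N * ∑ i, (f * pderiv i (H i) - q * H i * pderiv i f)) :
    ∃ (q : ℕ) (H : Fin n → MvPolynomial (Fin n) K),
      dehom L * dehom f ^ (q + 1) = dehom f ^ N *
        ∑ i, (dehom f * pderiv i (H i) - q * H i * pderiv i (dehom f)) := by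
  have hle : n + 1 ≤ (q + (n + 1)) * d := by nlinarith
  obtain ⟨a, ha⟩ := Nat.exists_eq_add_of_le hle
  have hraise : L * f ^ (q + (n + 1) + 1) = f ^ N * ∑ i, (f * pderiv i (H i * f ^ (n + 1))
      - ((q + (n + 1) : ℕ) : MvPolynomial (Fin (n + 1)) K) * (H i * f ^ (n + 1))
        * pderiv i f) := by
    simp only [certificate_raise, ← Finset.mul_sum]
    linear_combination f ^ (n + 1) * h
  have hfN := hf.pow N
  have hcomp := congrArg (homogeneousComponent (d * N + (d + a))) hraise
  have hLhom : (L * f ^ (q + (n + 1) + 1)).IsHomogeneous (d * N + (d + a)) := by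
    have := hL.mul (hf.pow (q + (n + 1) + 1))
    convert this using 1
    linarith [show d * (q + (n + 1) + 1) = (q + (n + 1)) * d + d by ring, mul_comm d N]
  rw [homogeneousComponent_eq_self hLhom, homogeneousComponent_mul_of_isHomogeneous hfN,
    map_sum] at hcomp
  simp only [homogeneousComponent_certificate hd hf] at hcomp
  have hdehom := congrArg dehom hcomp
  rw [map_mul, map_pow, map_mul, map_pow, dehom_certificate hf
    (homogeneousComponent_isHomogeneous _ _) (by omega)] at hdehom
  exact ⟨_, _, hdehom⟩

theorem map_eval_zero_fReg {k : Type*} [Field k] (n d : ℕ)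
    (f : MvPolynomial (Fin (n + 1)) (Polynomial k)) :
    MvPolynomial.map (Polynomial.evalRingHom 0) (fReg n d f) = f := by
  have hc : (Polynomial.evalRingHom (0 : Polynomial k)).comp Polynomial.C = RingHom.id _ := by
    ext <;> simp
  rw [fReg, map_add, MvPolynomial.map_map, hc, MvPolynomial.map_id, map_mul, map_C,
    Polynomial.coe_evalRingHom, Polynomial.eval_X, map_zero, zero_mul, add_zero]

theorem map_eval_zero_map_mapRingHom {R S σ : Type*} [CommRing R] [CommRing S] (α : R →+* S)
    (p : MvPolynomial σ (Polynomial R)) :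
    MvPolynomial.map (Polynomial.evalRingHom 0) (MvPolynomial.map (Polynomial.mapRingHom α) p)
      = MvPolynomial.map α (MvPolynomial.map (Polynomial.evalRingHom 0) p) := by
  rw [MvPolynomial.map_map, MvPolynomial.map_map]
  congr 2
  ext <;> simp

/-- Proposition 5: if `c_0,…,c_r ∈ k(t)[ε]` is a telescoper with regular certificate
for `b/f_reg^ℓ` over `k(t,ε)`, where `f_reg = f + ε·Σ_i x_i^d`, then the evaluations
`c_j|_{ε=0}` form a telescoping family with regular certificate for the
dehomogenized fraction `b̄/f̄^ℓ` in the `n` affine variables. -/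
theorem telescoper_specialize_eps_zero {k : Type*} [Field k] [CharZero k]
    (n : ℕ) (hn : 1 ≤ n) (d : ℕ) (hd : 1 ≤ d) (ℓ : ℕ) (hℓ : 1 ≤ ℓ)
    (f b : MvPolynomial (Fin (n + 1)) (Polynomial k))
    (hf : f.IsHomogeneous d)
    (hbdeg : n + 1 ≤ ℓ * d) (hb : b.IsHomogeneous (ℓ * d - (n + 1)))
    (r : ℕ) (c : ℕ → Polynomial (RatFunc k))
    (hc : ∃ (m : ℕ) (B : Fin (n + 1) → MvPolynomial (Fin (n + 1)) (RatFunc (RatFunc k))),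
      (∑ j ∈ Finset.range (r + 1),
          MvPolynomial.C (algebraMap (Polynomial (RatFunc k)) (RatFunc (RatFunc k)) (c j))
            * MvPolynomial.map toKtε
                (telSeq dtMvE (fReg n d f)
                  (MvPolynomial.map (Polynomial.C : Polynomial k →+* Polynomial (Polynomial k)) b)
                  ℓ j)
            * (MvPolynomial.map toKtε (fReg n d f)) ^ (r - j))
          * (MvPolynomial.map toKtε (fReg n d f)) ^ (m + 1)
        = (MvPolynomial.map toKtε (fReg n d f)) ^ (ℓ + r) *
            ∑ i : Fin (n + 1),
              (MvPolynomial.map toKtε (fReg n d f) * pderiv i (B i)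
                - (m : MvPolynomial (Fin (n + 1)) (RatFunc (RatFunc k))) * B i *
                    pderiv i (MvPolynomial.map toKtε (fReg n d f)))) :
    ∃ (q : ℕ) (h : Fin n → MvPolynomial (Fin n) (RatFunc k)),
      (∑ j ∈ Finset.range (r + 1),
          MvPolynomial.C (Polynomial.eval 0 (c j))
            * MvPolynomial.map (algebraMap (Polynomial k) (RatFunc k))
                (telSeq dtMv (dehom f) (dehom b) ℓ j)
            * (MvPolynomial.map (algebraMap (Polynomial k) (RatFunc k)) (dehom f)) ^ (r - j))
          * (MvPolynomial.map (algebraMap (Polynomial k) (RatFunc k)) (dehom f)) ^ (q + 1)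
        = (MvPolynomial.map (algebraMap (Polynomial k) (RatFunc k)) (dehom f)) ^ (ℓ + r) *
            ∑ i : Fin n,
              (MvPolynomial.map (algebraMap (Polynomial k) (RatFunc k)) (dehom f) * pderiv i (h i)
                - (q : MvPolynomial (Fin n) (RatFunc k)) * h i *
                    pderiv i (MvPolynomial.map (algebraMap (Polynomial k) (RatFunc k)) (dehom f))) := by
  obtain ⟨m, B, hc⟩ := hc
  set α := algebraMap (Polynomial k) (RatFunc k)
  have hα : Function.Injective α := IsFractionRing.injective _ _
  rcases eq_or_ne f 0 with rfl | hf0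
  · refine ⟨0, 0, ?_⟩
    rw [map_zero, map_zero, zero_pow (by omega), zero_pow (by omega), mul_zero, zero_mul]
  set g := MvPolynomial.map (Polynomial.mapRingHom α) (fReg n d f)
  set P : ℕ → MvPolynomial (Fin (n + 1)) (Polynomial (RatFunc k)) := fun j =>
    MvPolynomial.map (Polynomial.mapRingHom α) (telSeq dtMvE (fReg n d f)
      (MvPolynomial.map Polynomial.C b) ℓ j) with hP
  set L := ∑ j ∈ Finset.range (r + 1), MvPolynomial.C (c j) * P j * g ^ (r - j) with hL
  have htoKtε (p : MvPolynomial (Fin (n + 1)) (Polynomial (Polynomial k))) :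
      MvPolynomial.map toKtε p = MvPolynomial.map (algebraMap _ (RatFunc (RatFunc k)))
        (MvPolynomial.map (Polynomial.mapRingHom α) p) := by
    rw [MvPolynomial.map_map]; rfl
  have hg : MvPolynomial.map (Polynomial.evalRingHom 0) g = MvPolynomial.map α f := by
    rw [map_eval_zero_map_mapRingHom, map_eval_zero_fReg]
  have hPeval (j : ℕ) : MvPolynomial.map (Polynomial.evalRingHom 0) (P j)
      = MvPolynomial.map α (telSeq dtMv f b ℓ j) := by
    have hid : (Polynomial.evalRingHom (0 : Polynomial k)).comp Polynomial.C = RingHom.id _ := by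
      ext <;> simp
    rw [hP, map_eval_zero_map_mapRingHom, map_telSeq _ map_eval_zero_dtMvE, map_eval_zero_fReg,
      MvPolynomial.map_map, hid, MvPolynomial.map_id]
  have hLeval : MvPolynomial.map (Polynomial.evalRingHom 0) L
      = ∑ j ∈ Finset.range (r + 1), MvPolynomial.C (Polynomial.eval 0 (c j))
        * MvPolynomial.map α (telSeq dtMv f b ℓ j) * MvPolynomial.map α f ^ (r - j) := by
    simp only [hL, map_sum, map_mul, map_pow, map_C, hPeval, hg, Polynomial.coe_evalRingHom]
  have hfα0 : MvPolynomial.map α f ≠ 0 :=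
    (map_ne_zero_iff _ (MvPolynomial.map_injective α hα)).2 hf0
  obtain ⟨q, H, hq⟩ := exists_certificate_of_ratFunc (MvPolynomial.map α f) hfα0 g L hg m (ℓ + r) B
    (by simpa only [hL, hP, htoKtε, map_sum, map_mul, map_pow, map_C] using hc)
  have hfα : (MvPolynomial.map α f).IsHomogeneous d := hf.map α
  have hLhom : (MvPolynomial.map (Polynomial.evalRingHom 0) L).IsHomogeneous
      (ℓ * d - (n + 1) + r * d) := by
    rw [hLeval]
    refine IsHomogeneous.sum _ _ _ fun j hj => ?_
    have hj : j ≤ r := Nat.lt_succ_iff.1 (Finset.mem_range.1 hj)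
    have := (((isHomogeneous_telSeq hf hb ℓ j).map α).C_mul (Polynomial.eval 0 (c j))).mul
      (hfα.pow (r - j))
    convert this using 1
    rw [add_assoc, mul_comm d, ← add_mul, Nat.add_sub_of_le hj]
  obtain ⟨q, H, hq⟩ := exists_certificate_dehom hd hfα hLhom
    (by rw [add_mul]; omega) hq
  have hdehom (j : ℕ) := map_telSeq dehom dehom_dtMv f b ℓ j
  refine ⟨q, H, ?_⟩
  simpa only [hLeval, map_sum, map_mul, map_pow, dehom_C, dehom_map, hdehom] using hq
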